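/- Let q be an acyclic Boolean conjunctive query and τ a join tree for q. If the attack graph of τ contains a strong cycle, then it contains a strong cycle of length 2; that is, there exist distinct atoms F, G of q with F ↝ G and G ↝ F in the attack graph of τ such that at least one of these two attacks is strong. -/

import Mathlib

attribute [local instance] Classical.propDecidable

noncomputable section

/-- A term is either a variable (`Sum.inl v`) or a constant (`Sum.inr c`),
variables and constants both being coded by natural numbers
(the two copies of `ℕ` are disjoint). -/
abbrev Trm := ℕ ⊕ ℕ

/-- A database schema assigns to every relation name (a natural number) an
arity `n` and a primary-key length `k` with `n ≥ k ≥ 1`; the primary key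
consists of the first `k` positions. -/
structure Schema where
  arity : ℕ → ℕ
  keyLen : ℕ → ℕ
  keyLen_le_arity : ∀ R, keyLen R ≤ arity R
  one_le_keyLen : ∀ R, 1 ≤ keyLen R

/-- An atom: a relation name together with a list of arguments. -/
structure Atom where
  rel : ℕ
  args : List Trm
deriving DecidableEq

/-- Variables occurring in a list of terms. -/
def varsL (l : List Trm) : Finset ℕ := (l.filterMap Sum.getLeft?).toFinset

/-- Constants occurring in a list of terms. -/
def constsL (l : List Trm) : Finset ℕ := (l.filterMap Sum.getRight?).toFinset

/-- All variables of an atom. -/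
def varsA (A : Atom) : Finset ℕ := varsL A.args

/-- Key variables of an atom: variables in the primary-key positions. -/
def keyVars (S : Schema) (A : Atom) : Finset ℕ := varsL (A.args.take (S.keyLen A.rel))

/-- Constants of an atom. -/
def constsA (A : Atom) : Finset ℕ := constsL A.args

/-- Well-formed atom: number of arguments equals the arity of its relation name. -/
def wfAtom (S : Schema) (A : Atom) : Prop := A.args.length = S.arity A.rel

/-- A fact is an atom without variables. -/
def isFact (A : Atom) : Prop := ∀ t ∈ A.args, ∃ c : ℕ, t = Sum.inr c

/-- Two (facts) are key-equal: same relation name, and same primary-key positions. -/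
def keyEqual (S : Schema) (A B : Atom) : Prop :=
  A.rel = B.rel ∧ A.args.take (S.keyLen A.rel) = B.args.take (S.keyLen B.rel)

/-- The block of `A` in `db`: all facts of `db` key-equal to `A`. -/
def block (S : Schema) (A : Atom) (db : Finset Atom) : Finset Atom :=
  db.filter (fun B => keyEqual S A B)

/-- An uncertain database: a finite set of well-formed facts. -/
def IsDb (S : Schema) (db : Finset Atom) : Prop := ∀ A ∈ db, isFact A ∧ wfAtom S A

/-- A set of facts is consistent if it contains no two distinct key-equal facts. -/
def Consistent (S : Schema) (db : Finset Atom) : Prop :=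
  ∀ A ∈ db, ∀ B ∈ db, keyEqual S A B → A = B

/-- A repair of `db`: a maximal consistent subset of `db`. -/
def IsRepair (S : Schema) (db r : Finset Atom) : Prop :=
  r ⊆ db ∧ Consistent S r ∧
    ∀ r' : Finset Atom, r ⊆ r' → r' ⊆ db → Consistent S r' → r' = r

/-- Applying a valuation (a total map from variables to constants) to a term. -/
def appT (θ : ℕ → ℕ) : Trm → Trm
  | Sum.inl v => Sum.inr (θ v)
  | Sum.inr c => Sum.inr c

/-- Applying a valuation to an atom. -/
def appA (θ : ℕ → ℕ) (A : Atom) : Atom := ⟨A.rel, A.args.map (appT θ)⟩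

/-- Applying a valuation to a query. -/
def appQ (θ : ℕ → ℕ) (q : Finset Atom) : Finset Atom := q.image (appA θ)

/-- `db ⊨ q`: some valuation sends every atom of `q` into `db`. -/
def Sat (db q : Finset Atom) : Prop := ∃ θ : ℕ → ℕ, appQ θ q ⊆ db

/-- `db ∈ CERTAINTY(q)`: every repair of `db` satisfies `q`. -/
def Certainty (S : Schema) (q db : Finset Atom) : Prop :=
  ∀ r : Finset Atom, IsRepair S db r → Sat r q

/-- Variables of a query. -/
def varsQ (q : Finset Atom) : Finset ℕ := q.biUnion varsA

/-- Constants of a query. -/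
def constsQ (q : Finset Atom) : Finset ℕ := q.biUnion constsA

/-- `q` has no self-join: no two distinct atoms share a relation name. -/
def NoSelfJoin (q : Finset Atom) : Prop := ∀ F ∈ q, ∀ G ∈ q, F.rel = G.rel → F = G

/-- `db` is purified relative to `q`. -/
def Purified (q db : Finset Atom) : Prop :=
  ∀ A ∈ db, ∃ θ : ℕ → ℕ, A ∈ appQ θ q ∧ appQ θ q ⊆ db

/-- Active domain of a database: all constants occurring in its facts. -/
def adom (db : Finset Atom) : Finset ℕ := db.biUnion constsA

/-- Membership in the attribute closure of `X` under a set `FDs` of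
functional dependencies (standard implication of functional dependencies). -/
inductive InCl (FDs : Set (Finset ℕ × Finset ℕ)) (X : Finset ℕ) : ℕ → Prop
  | base {x : ℕ} : x ∈ X → InCl FDs X x
  | step {Z W : Finset ℕ} {w : ℕ} : (Z, W) ∈ FDs → (∀ z ∈ Z, InCl FDs X z) →
      w ∈ W → InCl FDs X w

/-- `FDs ⊨ X → Y`. -/
def FDImp (FDs : Set (Finset ℕ × Finset ℕ)) (X Y : Finset ℕ) : Prop :=
  ∀ y ∈ Y, InCl FDs X y

/-- `FD(q) = { key(F) → vars(F) : F ∈ q }`. -/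
def FDq (S : Schema) (q : Finset Atom) : Set (Finset ℕ × Finset ℕ) :=
  {p | ∃ F ∈ q, p = (keyVars S F, varsA F)}

/-- `F^{+,q} = {x ∈ vars(q) : FD(q \ {F}) ⊨ key(F) → x}`. -/
def plusCl (S : Schema) (q : Finset Atom) (F : Atom) : Set ℕ :=
  {x | x ∈ varsQ q ∧ InCl (FDq S (q.erase F)) (keyVars S F) x}

/-- `F^{⊕,q} = {x ∈ vars(q) : FD(q) ⊨ key(F) → x}`. -/
def oplusCl (S : Schema) (q : Finset Atom) (F : Atom) : Set ℕ :=
  {x | x ∈ varsQ q ∧ InCl (FDq S q) (keyVars S F) x}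

/-- A (simple) path in an undirected graph given by edge relation `E`. -/
def IsPath (E : Atom → Atom → Prop) (p : List Atom) : Prop :=
  p ≠ [] ∧ p.Nodup ∧ List.Chain' E p

/-- `E` is (the edge relation of) a join tree for `q`: a tree (unique simple
paths between any two vertices) on the atoms of `q` satisfying the
Connectedness Condition. -/
def IsJoinTree (q : Finset Atom) (E : Atom → Atom → Prop) : Prop :=
  (∀ a b, E a b → E b a) ∧
  (∀ a b, E a b → a ∈ q ∧ b ∈ q ∧ a ≠ b) ∧
  (∀ a ∈ q, ∀ b ∈ q, ∃! p : List Atom,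
      IsPath E p ∧ p.head? = some a ∧ p.getLast? = some b) ∧
  (∀ x : ℕ, ∀ F ∈ q, ∀ G ∈ q, x ∈ varsA F → x ∈ varsA G →
      ∀ p : List Atom, IsPath E p → p.head? = some F → p.getLast? = some G →
        ∀ H ∈ p, x ∈ varsA H)

/-- The consecutive pairs (edges) of a path. -/
def edgePairs (p : List Atom) : List (Atom × Atom) := p.zip p.tail

/-- `F ↝ G` in the attack graph of the join tree `E` of `q`: `F ≠ G` are atoms
of `q`, and no label `vars(H) ∩ vars(H')` of an edge on the (unique) path from
`F` to `G` is contained in `F^{+,q}`. -/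
def Attacks (S : Schema) (q : Finset Atom) (E : Atom → Atom → Prop) (F G : Atom) : Prop :=
  F ∈ q ∧ G ∈ q ∧ F ≠ G ∧
  ∀ p : List Atom, IsPath E p → p.head? = some F → p.getLast? = some G →
    ∀ e ∈ edgePairs p, ¬ ((↑(varsA e.1 ∩ varsA e.2) : Set ℕ) ⊆ plusCl S q F)

/-- The attack `F ↝ G` is weak: `key(G) ⊆ F^{⊕,q}`. -/
def Weak (S : Schema) (q : Finset Atom) (F G : Atom) : Prop :=
  (↑(keyVars S G) : Set ℕ) ⊆ oplusCl S q F

/-- Consecutive pairs of a cyclic sequence, including the wrap-around pair. -/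
def cyclePairs (L : List Atom) : List (Atom × Atom) := L.zip (L.rotate 1)

/-- `L` is an (elementary directed) cycle in the directed graph `att`. -/
def IsCycle (att : Atom → Atom → Prop) (L : List Atom) : Prop :=
  2 ≤ L.length ∧ L.Nodup ∧ ∀ e ∈ cyclePairs L, att e.1 e.2

/-- A cycle is terminal: no edge leads from a vertex in the cycle to a vertex
outside the cycle. -/
def TerminalCycle (att : Atom → Atom → Prop) (L : List Atom) : Prop :=
  ∀ a ∈ L, ∀ b, att a b → b ∈ L

/-- A strong cycle in the attack graph: a cycle at least one attack of which is strong. -/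
def StrongCycle (S : Schema) (q : Finset Atom) (E : Atom → Atom → Prop)
    (L : List Atom) : Prop :=
  IsCycle (Attacks S q E) L ∧ ∃ e ∈ cyclePairs L, ¬ Weak S q e.1 e.2

/-- Substituting constant `c` for variable `z` in a term. -/
def substT (z c : ℕ) : Trm → Trm
  | Sum.inl v => if v = z then Sum.inr c else Sum.inl v
  | Sum.inr d => Sum.inr d

/-- `F[z→c]`. -/
def substA (z c : ℕ) (A : Atom) : Atom := ⟨A.rel, A.args.map (substT z c)⟩

/-- `q[z→c]`. -/
def substQ (z c : ℕ) (q : Finset Atom) : Finset Atom := q.image (substA z c)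

/-- Simultaneous substitution of the constants `bs` for the (distinct)
variables `xs` (componentwise) in a term. -/
def substLT (xs bs : List ℕ) : Trm → Trm
  | Sum.inl v => if v ∈ xs then Sum.inr (bs.getD (xs.idxOf v) 0) else Sum.inl v
  | Sum.inr d => Sum.inr d

/-- `F[x⃗→b⃗]`. -/
def substLA (xs bs : List ℕ) (A : Atom) : Atom := ⟨A.rel, A.args.map (substLT xs bs)⟩

/-- `q[x⃗→b⃗]`. -/
def substLQ (xs bs : List ℕ) (q : Finset Atom) : Finset Atom := q.image (substLA xs bs)

/-- First-order formulas over the relational vocabulary (relation names and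
constants coded by naturals, variables coded by naturals). -/
inductive Fml where
  | atom (R : ℕ) (args : List Trm)
  | eq (s t : Trm)
  | tru
  | not (φ : Fml)
  | and (φ ψ : Fml)
  | or (φ ψ : Fml)
  | ex (v : ℕ) (φ : Fml)
  | all (v : ℕ) (φ : Fml)

/-- Value of a term under an assignment of constants to variables. -/
def evalT (σ : ℕ → ℕ) : Trm → ℕ
  | Sum.inl v => σ v
  | Sum.inr c => c

/-- Satisfaction of a first-order formula in the finite structure whose
relations are given by the facts of `db`, with quantifiers ranging over `dom`. -/
def Holds (db : Finset Atom) (dom : Finset ℕ) : Fml → (ℕ → ℕ) → Prop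
  | .atom R args, σ => (⟨R, args.map fun t => Sum.inr (evalT σ t)⟩ : Atom) ∈ db
  | .eq s t, σ => evalT σ s = evalT σ t
  | .tru, _ => True
  | .not φ, σ => ¬ Holds db dom φ σ
  | .and φ ψ, σ => Holds db dom φ σ ∧ Holds db dom ψ σ
  | .or φ ψ, σ => Holds db dom φ σ ∨ Holds db dom ψ σ
  | .ex v φ, σ => ∃ a ∈ dom, Holds db dom φ (Function.update σ v a)
  | .all v φ, σ => ∀ a ∈ dom, Holds db dom φ (Function.update σ v a)

/-- Free variables of a formula. -/
def Fml.free : Fml → Finset ℕ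
  | .atom _ args => varsL args
  | .eq s t => varsL [s, t]
  | .tru => ∅
  | .not φ => φ.free
  | .and φ ψ => φ.free ∪ ψ.free
  | .or φ ψ => φ.free ∪ ψ.free
  | .ex v φ => φ.free.erase v
  | .all v φ => φ.free.erase v

/-- Relation names occurring in a formula. -/
def Fml.rels : Fml → Finset ℕ
  | .atom R _ => {R}
  | .eq _ _ => ∅
  | .tru => ∅
  | .not φ => φ.rels
  | .and φ ψ => φ.rels ∪ ψ.rels
  | .or φ ψ => φ.rels ∪ ψ.rels
  | .ex _ φ => φ.rels
  | .all _ φ => φ.rels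

/-- Constants occurring in a formula. -/
def Fml.consts : Fml → Finset ℕ
  | .atom _ args => constsL args
  | .eq s t => constsL [s, t]
  | .tru => ∅
  | .not φ => φ.consts
  | .and φ ψ => φ.consts ∪ ψ.consts
  | .or φ ψ => φ.consts ∪ ψ.consts
  | .ex _ φ => φ.consts
  | .all _ φ => φ.consts

/-- Well-formed formula: every atom has as many arguments as the arity of its
relation name. -/
def FmlWf (S : Schema) : Fml → Prop
  | .atom R args => args.length = S.arity R
  | .eq _ _ => True
  | .tru => True
  | .not φ => FmlWf S φ
  | .and φ ψ => FmlWf S φ ∧ FmlWf S ψ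
  | .or φ ψ => FmlWf S φ ∧ FmlWf S ψ
  | .ex _ φ => FmlWf S φ
  | .all _ φ => FmlWf S φ

/-- The safety predicate of Dalvi, Ré and Suciu (rules SE1–SE4). -/
inductive Safe (S : Schema) : Finset Atom → Prop
  | se1 (A : Atom) : isFact A → Safe S {A}
  | se2 (q₁ q₂ : Finset Atom) : q₁.Nonempty → q₂.Nonempty →
      Disjoint (varsQ q₁) (varsQ q₂) → Safe S q₁ → Safe S q₂ → Safe S (q₁ ∪ q₂)
  | se3 (q : Finset Atom) (x a : ℕ) : (∀ F ∈ q, x ∈ keyVars S F) →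
      Safe S (substQ x a q) → Safe S q
  | se4 (q : Finset Atom) (F : Atom) (x a : ℕ) : F ∈ q → keyVars S F = ∅ →
      varsA F ≠ ∅ → x ∈ varsA F → Safe S (substQ x a q) → Safe S q

/-- The atom `R_i(x_i ; x_{i+1})` (with `x_{k+1} = x_1`) of the query `acq_k`;
variable `x_i` is coded by `i`, relation name `R_i` by `i`. -/
def Ratom (k i : ℕ) : Atom := ⟨i, [Sum.inl i, Sum.inl (i % k + 1)]⟩

/-- The all-key atom `S_k(x_1,…,x_k)` of the query `acq_k`;
relation name `S_k` is coded by `0`. -/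
def Satom (k : ℕ) : Atom := ⟨0, (List.range k).map (fun j => Sum.inl (j + 1))⟩

/-- The query `acq_k = {R_1(x_1;x_2), …, R_k(x_k;x_1), S_k(x_1,…,x_k)}`. -/
def acq (k : ℕ) : Finset Atom := ((Finset.Icc 1 k).image (Ratom k)) ∪ {Satom k}

/-- Sum of `Pr` over the possible (= consistent) worlds of `db` satisfying `P`. -/
def prOf (S : Schema) (db : Finset Atom) (Pr : Finset Atom → ℚ)
    (P : Finset Atom → Prop) : ℚ :=
  ∑ w ∈ db.powerset.filter (fun w => Consistent S w ∧ P w), Pr w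

end

section Helpers

theorem isChain_of_edges {α : Type*} (R : α → α → Prop) :
    ∀ p : List α, List.IsChain R p ↔ ∀ e ∈ p.zip p.tail, R e.1 e.2
  | [] => by simp
  | [a] => by simp
  | a :: b :: l => by
    have ih := isChain_of_edges R (b :: l)
    simp only [List.tail_cons] at ih
    simp only [List.tail_cons, List.isChain_cons_cons, List.zip_cons_cons, List.forall_mem_cons, ih]

theorem chain_of_zip {α : Type*} (R : α → α → Prop) (b : α) :
    ∀ (l : List α) (a : α), (∀ e ∈ (a :: l).zip (l ++ [b]), R e.1 e.2) →
      List.IsChain R (a :: (l ++ [b]))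
  | [], a, h => by simpa using h
  | c :: l, a, h => by
    simp only [List.cons_append, List.zip_cons_cons, List.forall_mem_cons] at h
    simp only [List.cons_append, List.isChain_cons_cons]
    exact ⟨h.1, chain_of_zip R b l c h.2⟩

theorem reach_of_chain {α : Type*} (R : α → α → Prop) :
    ∀ (p : List α) (a b : α), List.IsChain R p → p.head? = some a → p.getLast? = some b →
      Relation.ReflTransGen R a b
  | [], a, b, _, h, _ => by simp at h
  | [c], a, b, _, h, hlast => by
    simp at h hlast
    subst h; subst hlast; exact .refl
  | c :: d :: l, a, b, hc, h, hlast => by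
    simp only [List.head?_cons, Option.some.injEq] at h
    subst h
    rw [List.isChain_cons_cons] at hc
    refine Relation.ReflTransGen.head hc.1 (reach_of_chain R (d :: l) d b hc.2 rfl ?_)
    simpa only [List.getLast?_cons_cons] using hlast

/-- Tree edge whose label is not contained in `F^+`. -/
def RR (S : Schema) (q : Finset Atom) (E : Atom → Atom → Prop) (F A B : Atom) : Prop :=
  E A B ∧ ¬ ((↑(varsA A ∩ varsA B) : Set ℕ) ⊆ plusCl S q F)

theorem path_chain {q : Finset Atom} {E : Atom → Atom → Prop} (hjt : IsJoinTree q E)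
    (Q : Atom → Atom → Prop) {F G : Atom} (hF : F ∈ q)
    (h : Relation.ReflTransGen (fun A B => E A B ∧ Q A B) F G) :
    ∀ p : List Atom, IsPath E p → p.head? = some F → p.getLast? = some G →
      List.IsChain Q p := by
  obtain ⟨hsym, hmem, huniq, hconn⟩ := hjt
  induction h with
  | refl =>
    intro p hp h1 h2
    have hs : IsPath E [F] := ⟨by simp, by simp, by simp [List.Chain']⟩
    have := (huniq F hF F hF).unique ⟨hp, h1, h2⟩ ⟨hs, rfl, rfl⟩
    subst this
    simp
  | @tail A B _ hAB ih =>
    intro p hp h1 h2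
    obtain ⟨hAq, hBq, _⟩ := hmem A B hAB.1
    obtain ⟨pA, ⟨hpA, hA1, hA2⟩, -⟩ := huniq F hF A hAq
    have hQ := ih pA hpA hA1 hA2
    by_cases hB : B ∈ pA
    · obtain ⟨s, t, rfl⟩ := List.append_of_mem hB
      have heq : s ++ B :: t = (s ++ [B]) ++ t := by simp
      rw [heq] at hpA hA1 hQ
      have hs : IsPath E (s ++ [B]) :=
        ⟨by simp, hpA.2.1.of_append_left, List.IsChain.left_of_append hpA.2.2⟩
      have h1' : (s ++ [B]).head? = some F := by
        cases s <;> simpa using hA1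
      have := (huniq F hF B hBq).unique ⟨hp, h1, h2⟩ ⟨hs, h1', by simp⟩
      subst this
      exact List.IsChain.left_of_append hQ
    · have key : ∀ R : Atom → Atom → Prop, R A B → List.IsChain R pA →
          List.IsChain R (pA ++ [B]) := by
        intro R hR hc
        rw [List.isChain_append]
        refine ⟨hc, by simp, ?_⟩
        intro x hx y hy
        rw [hA2] at hx
        simp at hx hy
        subst hx; subst hy; exact hR
      have hs : IsPath E (pA ++ [B]) := by
        refine ⟨by simp, ?_, key E hAB.1 hpA.2.2⟩
        rw [List.nodup_append]
        refine ⟨hpA.2.1, by simp, ?_⟩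
        intro a ha b hb hab
        simp at hb
        subst hab; subst hb; exact hB ha
      have h1' : (pA ++ [B]).head? = some F := by
        cases pA <;> simp_all
      have := (huniq F hF B hBq).unique ⟨hp, h1, h2⟩ ⟨hs, h1', by simp⟩
      subst this
      exact key Q hAB.2 hQ

theorem attacks_iff {S : Schema} {q : Finset Atom} {E : Atom → Atom → Prop}
    (hjt : IsJoinTree q E) (F G : Atom) :
    Attacks S q E F G ↔ F ∈ q ∧ G ∈ q ∧ F ≠ G ∧ Relation.ReflTransGen (RR S q E F) F G := by
  constructor
  · rintro ⟨hF, hG, hne, h⟩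
    refine ⟨hF, hG, hne, ?_⟩
    obtain ⟨p, ⟨hp, h1, h2⟩, -⟩ := hjt.2.2.1 F hF G hG
    refine reach_of_chain _ p F G ?_ h1 h2
    rw [isChain_of_edges]
    intro e he
    exact ⟨(isChain_of_edges E p).1 hp.2.2 e he, h p hp h1 h2 e he⟩
  · rintro ⟨hF, hG, hne, h⟩
    refine ⟨hF, hG, hne, ?_⟩
    intro p hp h1 h2
    have := path_chain hjt (fun A B => ¬ ((↑(varsA A ∩ varsA B) : Set ℕ) ⊆ plusCl S q F)) hF h
      p hp h1 h2
    exact (isChain_of_edges _ p).1 this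

theorem keyVars_sub (S : Schema) (A : Atom) {x : ℕ} (h : x ∈ keyVars S A) : x ∈ varsA A := by
  simp only [keyVars, varsA, varsL, List.mem_toFinset, List.mem_filterMap] at *
  obtain ⟨a, ha, hx⟩ := h
  exact ⟨a, List.mem_of_mem_take ha, hx⟩

theorem mem_varsQ {q : Finset Atom} {A : Atom} (hA : A ∈ q) {x : ℕ} (h : x ∈ varsA A) :
    x ∈ varsQ q := Finset.mem_biUnion.2 ⟨A, hA, h⟩

theorem RR_mem {S : Schema} {q : Finset Atom} {E : Atom → Atom → Prop}
    (hjt : IsJoinTree q E) {F A B : Atom} (hA : A ∈ q)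
    (h : Relation.ReflTransGen (RR S q E F) A B) : B ∈ q := by
  induction h with
  | refl => exact hA
  | tail _ h _ => exact (hjt.2.1 _ _ h.1).2.1

/-- Connectedness: a variable outside `G^+` keeps us inside the component. -/
theorem conn_lemma {S : Schema} {q : Finset Atom} {E : Atom → Atom → Prop}
    (hjt : IsJoinTree q E) {G A B : Atom} (hA : A ∈ q) (hB : B ∈ q) {x : ℕ}
    (hxA : x ∈ varsA A) (hxB : x ∈ varsA B) (hx : x ∉ plusCl S q G) :
    Relation.ReflTransGen (RR S q E G) A B := by
  obtain ⟨p, ⟨hp, h1, h2⟩, -⟩ := hjt.2.2.1 A hA B hB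
  have hall := hjt.2.2.2 x A hA B hB hxA hxB p hp h1 h2
  refine reach_of_chain _ p A B ?_ h1 h2
  rw [isChain_of_edges]
  rintro ⟨a, b⟩ he
  refine ⟨(isChain_of_edges E p).1 hp.2.2 _ he, fun hsub => hx (hsub ?_)⟩
  have := List.of_mem_zip he
  simp only [Finset.coe_inter, Set.mem_inter_iff, Finset.mem_coe]
  exact ⟨hall a this.1, hall b (List.mem_of_mem_tail this.2)⟩

theorem key_not_sub {S : Schema} {q : Finset Atom} {E : Atom → Atom → Prop}
    (hjt : IsJoinTree q E) {F G : Atom} (h : Attacks S q E F G) :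
    ¬ ∀ z ∈ keyVars S G, InCl (FDq S (q.erase F)) (keyVars S F) z := by
  intro hk
  obtain ⟨hF, hG, hne, hr⟩ := (attacks_iff hjt F G).1 h
  rcases Relation.ReflTransGen.cases_tail hr with h0 | ⟨A, -, hA⟩
  · exact hne h0.symm
  · refine hA.2 ?_
    intro x hx
    simp only [Finset.coe_inter, Set.mem_inter_iff, Finset.mem_coe] at hx
    exact ⟨mem_varsQ hG hx.2,
      InCl.step ⟨G, Finset.mem_erase.2 ⟨hne.symm, hG⟩, rfl⟩ hk hx.2⟩

theorem lemmaA {S : Schema} {q : Finset Atom} {E : Atom → Atom → Prop}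
    (hjt : IsJoinTree q E) {F G H : Atom} (h1 : Attacks S q E F G) (h2 : Attacks S q E G H) :
    Attacks S q E F H ∨ Attacks S q E G F := by
  by_contra hcon
  push Not at hcon
  obtain ⟨hFH, hGF⟩ := hcon
  have hne : F ≠ H := by rintro rfl; exact hGF h2
  obtain ⟨hF, hG, hFG, r1⟩ := (attacks_iff hjt F G).1 h1
  obtain ⟨-, hH, hGH, r2⟩ := (attacks_iff hjt G H).1 h2
  have hFnot : ¬ Relation.ReflTransGen (RR S q E G) G F := fun h =>
    hGF ((attacks_iff hjt G F).2 ⟨hG, hF, hFG.symm, h⟩)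
  have hHnot : ¬ Relation.ReflTransGen (RR S q E F) F H := fun h =>
    hFH ((attacks_iff hjt F H).2 ⟨hF, hH, hne, h⟩)
  -- main claim
  have claim : ∀ x, InCl (FDq S (q.erase F)) (keyVars S F) x →
      ∀ A, Relation.ReflTransGen (RR S q E G) G A → x ∈ varsA A → x ∈ plusCl S q G := by
    intro x hx
    induction hx with
    | base hx =>
      intro A hA hxA
      by_contra hn
      exact hFnot (hA.trans (conn_lemma hjt (RR_mem hjt hG hA) hF hxA (keyVars_sub S F hx) hn))
    | @step Z W w hZW hZ hw ih =>
      intro A hA hxA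
      obtain ⟨K, hK, hKe⟩ := hZW
      obtain ⟨rfl, rfl⟩ := Prod.mk.inj hKe
      obtain ⟨hKF, hKq⟩ := Finset.mem_erase.1 hK
      by_contra hn
      have hKr := hA.trans (conn_lemma hjt (RR_mem hjt hG hA) hKq hxA hw hn)
      have hKG : K ≠ G := by
        rintro rfl
        exact key_not_sub hjt h1 hZ
      exact hn ⟨mem_varsQ hKq hw, InCl.step ⟨K, Finset.mem_erase.2 ⟨hKG, hKq⟩, rfl⟩
        (fun z hz => (ih z hz K hKr (keyVars_sub S K hz)).2) hw⟩
  have fin : ∀ B, Relation.ReflTransGen (RR S q E G) G B →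
      Relation.ReflTransGen (RR S q E F) F B := by
    intro B hB
    induction hB with
    | refl => exact r1
    | @tail A B hA hAB ih =>
      refine ih.tail ⟨hAB.1, fun hsub => hAB.2 fun x hx => ?_⟩
      have hx' := hx
      simp only [Finset.coe_inter, Set.mem_inter_iff, Finset.mem_coe] at hx'
      exact claim x (hsub hx).2 A hA hx'.1
  exact hHnot (fin H r2)

theorem InCl_trans {FDs : Set (Finset ℕ × Finset ℕ)} {X Y : Finset ℕ}
    (h : ∀ y ∈ Y, InCl FDs X y) {x : ℕ} (hx : InCl FDs Y x) : InCl FDs X x := by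
  induction hx with
  | base hx => exact h _ hx
  | step hZ _ hw ih => exact InCl.step hZ ih hw

theorem weak_trans {S : Schema} {q : Finset Atom} {F G H : Atom}
    (h1 : Weak S q F G) (h2 : Weak S q G H) : Weak S q F H := fun x hx =>
  ⟨(h2 hx).1, InCl_trans (fun _ hy => (h1 hy).2) (h2 hx).2⟩

theorem strong_aux {S : Schema} {q : Finset Atom} {E : Atom → Atom → Prop}
    (hjt : IsJoinTree q E) : ∀ (n : ℕ) (rest : List Atom) (F G : Atom), rest.length = n →
      List.IsChain (Attacks S q E) (F :: G :: (rest ++ [F])) → ¬ Weak S q F G →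
    ∃ F G : Atom, F ≠ G ∧ Attacks S q E F G ∧ Attacks S q E G F ∧
      (¬ Weak S q F G ∨ ¬ Weak S q G F) := by
  intro n
  induction n with
  | zero =>
    intro rest F G hl hc hw
    obtain rfl := List.length_eq_zero_iff.1 hl
    simp at hc
    exact ⟨F, G, hc.1.2.2.1, hc.1, hc.2, Or.inl hw⟩
  | succ n ih =>
    intro rest F G hl hc hw
    obtain _ | ⟨H, rest⟩ := rest
    · simp at hl
    simp only [List.cons_append, List.isChain_cons_cons] at hc
    obtain ⟨hFG, hGH, hc⟩ := hc
    simp only [List.length_cons, Nat.add_right_cancel_iff] at hl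
    rcases lemmaA hjt hFG hGH with hFH | hGF
    swap
    · exact ⟨F, G, hFG.2.2.1, hFG, hGF, Or.inl hw⟩
    by_cases hwFH : Weak S q F H
    swap
    · exact ih rest F H hl (List.isChain_cons_cons.2 ⟨hFH, hc⟩) hwFH
    have done : Attacks S q E H G → ∃ F G : Atom, F ≠ G ∧ Attacks S q E F G ∧
        Attacks S q E G F ∧ (¬ Weak S q F G ∨ ¬ Weak S q G F) := fun hHG =>
      ⟨H, G, hHG.2.2.1, hHG, hGH, Or.inl fun h => hw (weak_trans hwFH h)⟩
    obtain _ | ⟨K, rest⟩ := rest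
    · simp at hc
      rcases lemmaA hjt hGH hc with h | h
      · exact ⟨F, G, hFG.2.2.1, hFG, h, Or.inl hw⟩
      · exact done h
    · simp only [List.cons_append, List.isChain_cons_cons] at hc
      rcases lemmaA hjt hGH hc.1 with h | h
      · refine ih (K :: rest) F G hl ?_ hw
        simp only [List.cons_append, List.isChain_cons_cons]
        exact ⟨hFG, h, hc.2⟩
      · exact done h

end Helpers

theorem statement4 (S : Schema) (q : Finset Atom) (hq : ∀ F ∈ q, wfAtom S F)
    (E : Atom → Atom → Prop) (hjt : IsJoinTree q E)
    (hstrong : ∃ L : List Atom, StrongCycle S q E L) :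
    ∃ F G : Atom, F ≠ G ∧ Attacks S q E F G ∧ Attacks S q E G F ∧
      (¬ Weak S q F G ∨ ¬ Weak S q G F) := by
  obtain ⟨L, ⟨hlen, -, hatt⟩, e, he, hw⟩ := hstrong
  obtain ⟨i, hi, rfl⟩ := List.getElem_of_mem he
  have hrot : cyclePairs (L.rotate i) = (cyclePairs L).rotate i := by
    unfold cyclePairs
    rw [List.rotate_rotate, Nat.add_comm, ← List.rotate_rotate]
    exact (List.zipWith_rotate_distrib Prod.mk L (L.rotate 1) i (by simp)).symm
  have hhead : (cyclePairs (L.rotate i)).head? = some ((cyclePairs L)[i]) := by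
    rw [hrot, List.head?_rotate hi, List.getElem?_eq_getElem hi]
  have hatt' : ∀ e ∈ cyclePairs (L.rotate i), Attacks S q E e.1 e.2 := by
    intro e he
    rw [hrot, List.mem_rotate] at he
    exact hatt e he
  have hlen' : 2 ≤ (L.rotate i).length := by simpa using hlen
  generalize (cyclePairs L)[i] = e at *
  generalize L.rotate i = M at *
  obtain _ | ⟨F, _ | ⟨G, rest⟩⟩ := M
  · simp at hlen'
  · simp at hlen'
  · simp only [cyclePairs, List.rotate_cons_succ, List.rotate_zero, List.cons_append,
      List.zip_cons_cons, List.head?_cons, Option.some.injEq] at hhead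
    subst hhead
    refine strong_aux hjt _ rest F G rfl ?_ hw
    refine chain_of_zip _ F (G :: rest) F ?_
    simpa [cyclePairs] using hatt'
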